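/- arXiv:2111.01197 — 3 statements merged into one kernel-verified Lean document; each statement's English description precedes it below -/
import Mathlib

section
/- Let α ∈ (0,1). Then Φ is decreasing on [0,∞): for all 0 ≤ x₁ < x₂ one has Φ(x₂) < Φ(x₁). -/
open MeasureTheory Real Set
/-- The function `Φ(x) = Σ (−1)ⁿ bₙ (x^{1+α}/(1+α))ⁿ`, where
`bₙ = ∏_{i<n} Γ(αi+i+2)/Γ(α(i+1)+i+2)`; it equals the generalized Mittag-Leffler
function `E_{α,1+1/α,1/α}(−x^{1+α}/(1+α))`. -/
noncomputable def PhiF (α : ℝ) (x : ℝ) : ℝ :=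
  ∑' n : ℕ, (-1:ℝ)^n *
    (∏ i ∈ Finset.range n, Real.Gamma (α * i + i + 2) / Real.Gamma (α * (i+1) + i + 2)) *
    (x ^ (1+α) / (1+α)) ^ n

open Filter Topology

/-- The (signed) coefficients of the power series defining `PhiF`. -/
noncomputable def phiCoeff (α : ℝ) (n : ℕ) : ℝ :=
  (-1:ℝ)^n *
    ∏ i ∈ Finset.range n, Real.Gamma (α * i + i + 2) / Real.Gamma (α * (i+1) + i + 2)

section PowerSeries

variable {a : ℕ → ℝ}

lemma nat_mul_pow_le {R : ℝ} (hR : 1 ≤ R) (n : ℕ) : n * R ^ (n - 1) ≤ (2 * R) ^ n := by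
  have h1 : (n : ℝ) ≤ 2 ^ n := by exact_mod_cast n.lt_two_pow_self.le
  rw [mul_pow]
  exact mul_le_mul h1 (pow_le_pow_right₀ hR (Nat.sub_le n 1)) (by positivity) (by positivity)

lemma summable_deriv_abs_mul_pow (ha : ∀ r : ℝ, 0 ≤ r → Summable fun n => |a n| * r ^ n)
    {R : ℝ} (hR : 1 ≤ R) : Summable fun n : ℕ => |a n| * (n * R ^ (n - 1)) :=
  (ha (2 * R) (by positivity)).of_nonneg_of_le (fun n => by positivity)
    fun n => mul_le_mul_of_nonneg_left (nat_mul_pow_le hR n) (abs_nonneg _)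

lemma summable_succ_abs_mul_pow (ha : ∀ r : ℝ, 0 ≤ r → Summable fun n => |a n| * r ^ n)
    (r : ℝ) (hr : 0 ≤ r) : Summable fun n : ℕ => |(n + 1) * a (n + 1)| * r ^ n := by
  have h := (summable_nat_add_iff 1).2 (summable_deriv_abs_mul_pow ha (R := r + 1) (by linarith))
  refine h.of_nonneg_of_le (fun n => by positivity) fun n => ?_
  rw [abs_mul, abs_of_nonneg (by positivity : (0 : ℝ) ≤ n + 1)]
  have : r ^ n ≤ (r + 1) ^ n := pow_le_pow_left₀ hr (by linarith) n
  calc (n + 1) * |a (n + 1)| * r ^ n ≤ (n + 1) * |a (n + 1)| * (r + 1) ^ n := by gcongr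
    _ = _ := by rw [Nat.add_sub_cancel]; push_cast; ring

/-- An everywhere absolutely convergent power series can be differentiated termwise. -/
lemma hasDerivAt_tsum_mul_pow (ha : ∀ r : ℝ, 0 ≤ r → Summable fun n => |a n| * r ^ n) (z : ℝ) :
    HasDerivAt (fun y => ∑' n, a n * y ^ n) (∑' n : ℕ, (n + 1) * a (n + 1) * z ^ n) z := by
  have hR : 1 ≤ |z| + 1 := by linarith [abs_nonneg z]
  have hu := summable_deriv_abs_mul_pow ha hR
  have hbound : ∀ (n : ℕ) (y : ℝ), y ∈ Metric.ball (0 : ℝ) (|z| + 1) →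
      ‖a n * (n * y ^ (n - 1))‖ ≤ |a n| * (n * (|z| + 1) ^ (n - 1)) := by
    intro n y hy
    rw [mem_ball_zero_iff, Real.norm_eq_abs] at hy
    rw [Real.norm_eq_abs, abs_mul, abs_mul, abs_pow, Nat.abs_cast]
    gcongr
  have hz : z ∈ Metric.ball (0 : ℝ) (|z| + 1) := by
    rw [mem_ball_zero_iff, Real.norm_eq_abs]; linarith
  have hz0 : Summable fun n => a n * z ^ n := by
    refine Summable.of_norm ?_
    simpa [abs_mul] using ha |z| (abs_nonneg z)
  have h := hasDerivAt_tsum_of_isPreconnected hu Metric.isOpen_ball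
    (convex_ball (0 : ℝ) (|z| + 1)).isPreconnected
    (fun n y _ => (hasDerivAt_pow n y).const_mul (a n)) hbound hz hz0 hz
  have hs : Summable fun n : ℕ => a n * (n * z ^ (n - 1)) :=
    Summable.of_norm_bounded hu fun n => hbound n z hz
  have e : ∑' n : ℕ, a n * (n * z ^ (n - 1)) = ∑' n : ℕ, (n + 1) * a (n + 1) * z ^ n := by
    rw [hs.tsum_eq_zero_add, Nat.cast_zero, zero_mul, mul_zero, zero_add]
    refine tsum_congr fun n => ?_
    rw [Nat.add_sub_cancel]; push_cast; ring
  exact e ▸ h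

end PowerSeries

/-- Log-convexity of `Γ` bounds the ratio `Γ(y) / Γ(y + α)`. -/
lemma Gamma_div_Gamma_add_le {α y : ℝ} (hα : α ∈ Set.Ioo (0:ℝ) 1) (hy : 1 < y) :
    Real.Gamma y / Real.Gamma (y + α) ≤ (y + α - 1) ^ (-α) := by
  obtain ⟨h0, h1⟩ := hα
  have h := Real.Gamma_mul_add_mul_le_rpow_Gamma_mul_rpow_Gamma (s := y + α) (t := y + α - 1)
    (a := 1 - α) (b := α) (by linarith) (by linarith) (by linarith) h0 (by ring)
  have hg : 0 < Real.Gamma (y + α - 1) := Real.Gamma_pos_of_pos (by linarith)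
  have hs : 0 < y + α - 1 := by linarith
  have hrec : Real.Gamma (y + α) = (y + α - 1) * Real.Gamma (y + α - 1) := by
    rw [← Real.Gamma_add_one hs.ne']; ring_nf
  have hG : 0 < Real.Gamma (y + α) := Real.Gamma_pos_of_pos (by linarith)
  rw [div_le_iff₀ hG]
  have e1 : (1 - α) * (y + α) + α * (y + α - 1) = y := by ring
  rw [e1] at h
  refine h.trans_eq ?_
  have e2 : Real.Gamma (y + α - 1) = (y + α - 1)⁻¹ * Real.Gamma (y + α) := by
    rw [hrec]; field_simp
  rw [e2, Real.mul_rpow (by positivity) hG.le, Real.inv_rpow hs.le, ← Real.rpow_neg hs.le,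
    Real.rpow_sub hG, Real.rpow_one]
  have : Real.Gamma (y + α) ^ α ≠ 0 := (Real.rpow_pos_of_pos hG _).ne'
  field_simp

lemma integral_rpow_mul_one_sub_rpow {a b : ℝ} (ha : 0 < a) (hb : 0 < b) :
    ∫ x in (0:ℝ)..1, x ^ (a - 1) * (1 - x) ^ (b - 1) =
      Real.Gamma a * Real.Gamma b / Real.Gamma (a + b) := by
  have h := ProbabilityTheory.beta_eq_betaIntegralReal a b ha hb
  rw [ProbabilityTheory.beta] at h
  rw [h, Complex.betaIntegral]
  rw [← Complex.ofReal_re (∫ x in (0:ℝ)..1, _), ← intervalIntegral.integral_ofReal]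
  congr 1
  refine intervalIntegral.integral_congr_ae (ae_of_all _ fun x hx => ?_)
  rw [uIoc_of_le zero_le_one] at hx
  have h1 : 0 ≤ 1 - x := by linarith [hx.2]
  rw [Complex.ofReal_mul, Complex.ofReal_cpow hx.1.le, Complex.ofReal_cpow h1]
  push_cast
  rfl

section Coefficients

variable {α : ℝ}

lemma phiCoeff_succ (n : ℕ) : phiCoeff α (n + 1) = -(phiCoeff α n *
    (Real.Gamma (α * n + n + 2) / Real.Gamma (α * (n+1) + n + 2))) := by
  simp only [phiCoeff, Finset.prod_range_succ, pow_succ]; ring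

lemma phiCoeff_ne_zero (hα : 0 < α) (n : ℕ) : phiCoeff α n ≠ 0 := by
  refine mul_ne_zero (by simp) (Finset.prod_ne_zero_iff.2 fun i _ => ?_)
  exact (div_pos (Real.Gamma_pos_of_pos (by positivity))
    (Real.Gamma_pos_of_pos (by positivity))).ne'

lemma summable_phiCoeff (hα : α ∈ Set.Ioo (0:ℝ) 1) (r : ℝ) (hr : 0 ≤ r) :
    Summable fun n => |phiCoeff α n| * r ^ n := by
  obtain rfl | hr := hr.eq_or_lt
  · exact summable_of_ne_finset_zero (s := {0}) fun n hn => by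
      simp [show n ≠ 0 by simpa using hn]
  have h0 := hα.1
  refine summable_of_ratio_test_tendsto_lt_one zero_lt_one (.of_forall fun n => ?_) ?_
  · exact mul_ne_zero (abs_ne_zero.2 (phiCoeff_ne_zero h0 n)) (by positivity)
  have hlim : Tendsto (fun n : ℕ => ((α + 1) * n + (α + 1)) ^ (-α) * r) atTop (𝓝 0) := by
    have h1 : Tendsto (fun n : ℕ => (α + 1) * (n : ℝ) + (α + 1)) atTop atTop :=
      tendsto_atTop_add_const_right _ _
        (tendsto_natCast_atTop_atTop.const_mul_atTop (by linarith))
    simpa using ((tendsto_rpow_neg_atTop h0).comp h1).mul_const r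
  refine squeeze_zero (fun n => by positivity) (fun n => ?_) hlim
  have hp : 0 < Real.Gamma (α * n + n + 2) := Real.Gamma_pos_of_pos (by positivity)
  have hq : 0 < Real.Gamma (α * (n + 1) + n + 2) := Real.Gamma_pos_of_pos (by positivity)
  have hc := abs_pos.2 (phiCoeff_ne_zero h0 n)
  have h := Gamma_div_Gamma_add_le (y := α * n + n + 2) hα (by
    have : 0 ≤ α * n := by positivity
    have : (0:ℝ) ≤ n := by positivity
    linarith)
  have e : (‖|phiCoeff α (n + 1)| * r ^ (n + 1)‖ / ‖|phiCoeff α n| * r ^ n‖) =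
      Real.Gamma (α * n + n + 2) / Real.Gamma (α * n + n + 2 + α) * r := by
    rw [phiCoeff_succ, abs_neg, abs_mul, abs_of_pos (div_pos hp hq)]
    have e2 : α * n + n + 2 + α = α * (n + 1) + n + 2 := by ring
    simp only [norm_mul, Real.norm_eq_abs, abs_abs, norm_pow, abs_of_pos hr, e2,
      abs_of_pos (div_pos hp hq)]
    rw [pow_succ]
    field_simp
  rw [e]
  refine mul_le_mul_of_nonneg_right (h.trans_eq ?_) hr.le
  congr 1; ring

end Coefficients

/-- The entire function `F` with `PhiF α x = F (x ^ (1 + α) / (1 + α))`. -/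
noncomputable def phiSeries (α z : ℝ) : ℝ := ∑' n, phiCoeff α n * z ^ n

/-- Minus the derivative of `phiSeries`. -/
noncomputable def negPhiDeriv (α z : ℝ) : ℝ :=
  ∑' n : ℕ, -((n + 1) * phiCoeff α (n + 1)) * z ^ n

section Series

variable {α : ℝ}

lemma hasDerivAt_phiSeries (hα : α ∈ Set.Ioo (0:ℝ) 1) (z : ℝ) : HasDerivAt (phiSeries α) (-negPhiDeriv α z) z := by
  have h := hasDerivAt_tsum_mul_pow (summable_phiCoeff hα) z
  have e : -negPhiDeriv α z = ∑' n : ℕ, (n + 1) * phiCoeff α (n + 1) * z ^ n := by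
    simp only [negPhiDeriv, neg_mul, tsum_neg, neg_neg]
  rw [e]
  exact h

lemma summable_negPhiDeriv (hα : α ∈ Set.Ioo (0:ℝ) 1) (r : ℝ) (hr : 0 ≤ r) :
    Summable fun n : ℕ => |-((n + 1) * phiCoeff α (n + 1))| * r ^ n := by
  simpa only [abs_neg] using summable_succ_abs_mul_pow (summable_phiCoeff hα) r hr

lemma differentiable_negPhiDeriv (hα : α ∈ Set.Ioo (0:ℝ) 1) : Differentiable ℝ (negPhiDeriv α) := fun z =>
  (hasDerivAt_tsum_mul_pow (summable_negPhiDeriv hα) z).differentiableAt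

lemma negPhiDeriv_zero_pos (hα : α ∈ Set.Ioo (0:ℝ) 1) : 0 < negPhiDeriv α 0 := by
  have h0 := hα.1
  have : negPhiDeriv α 0 = Real.Gamma 2 / Real.Gamma (α + 2) := by
    rw [negPhiDeriv, tsum_eq_single 0 (fun n hn => by simp [hn])]
    simp [phiCoeff]
  rw [this]
  exact div_pos (Real.Gamma_pos_of_pos (by norm_num)) (Real.Gamma_pos_of_pos (by linarith))

/-- The Volterra equation satisfied by the series, on the unit interval. -/
lemma integral_negPhiDeriv_unit (hα : α ∈ Set.Ioo (0:ℝ) 1) {z : ℝ} (hz : 0 ≤ z) :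
    ∫ s in (0:ℝ)..1, (1 - s) ^ (-α) * (s ^ α * negPhiDeriv α (z * s ^ (1 + α))) =
      Real.Gamma (1 - α) / (1 + α) * phiSeries α z := by
  obtain ⟨h0, h1⟩ := hα
  set c : ℕ → ℝ := fun n => -((n + 1) * phiCoeff α (n + 1)) with hc
  have hker : IntervalIntegrable (fun s : ℝ => (1 - s) ^ (-α)) volume 0 1 := by
    have h := (intervalIntegral.intervalIntegrable_rpow' (a := 1) (b := 0) (r := -α)
      (by linarith)).comp_sub_left 1
    simpa using h
  have hsum := summable_negPhiDeriv ⟨h0, h1⟩ z hz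
  have key := intervalIntegral.hasSum_integral_of_dominated_convergence (μ := volume)
    (a := 0) (b := 1)
    (F := fun (n : ℕ) (s : ℝ) => (1 - s) ^ (-α) * (s ^ α * (c n * (z * s ^ (1 + α)) ^ n)))
    (f := fun s => (1 - s) ^ (-α) * (s ^ α * negPhiDeriv α (z * s ^ (1 + α))))
    (fun n s => (1 - s) ^ (-α) * (|c n| * z ^ n))
    (fun n => by
      refine Measurable.aestronglyMeasurable ?_
      fun_prop)
    (fun n => ae_of_all _ fun s hs => by
      rw [uIoc_of_le zero_le_one] at hs
      have hs1 : 0 ≤ 1 - s := by linarith [hs.2]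
      rw [norm_mul, Real.norm_of_nonneg (Real.rpow_nonneg hs1 _)]
      refine mul_le_mul_of_nonneg_left ?_ (Real.rpow_nonneg hs1 _)
      have i1 : s ^ α ≤ 1 := Real.rpow_le_one hs.1.le hs.2 h0.le
      have i2 : s ^ (1 + α) ≤ 1 := Real.rpow_le_one hs.1.le hs.2 (by linarith)
      have i3 : 0 ≤ s ^ α := Real.rpow_nonneg hs.1.le _
      have i4 : 0 ≤ s ^ (1 + α) := Real.rpow_nonneg hs.1.le _
      rw [norm_mul, norm_mul, norm_pow, Real.norm_of_nonneg i3,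
        Real.norm_of_nonneg (mul_nonneg hz i4), Real.norm_eq_abs]
      calc s ^ α * (|c n| * (z * s ^ (1 + α)) ^ n) ≤ 1 * (|c n| * (z * 1) ^ n) := by gcongr
        _ = _ := by ring)
    (ae_of_all _ fun s _ => hsum.mul_left _)
    (by simpa only [tsum_mul_left] using hker.mul_const _)
    (ae_of_all _ fun s hs => by
      rw [uIoc_of_le zero_le_one] at hs
      refine HasSum.mul_left _ (HasSum.mul_left _ (Summable.hasSum ?_))
      refine Summable.of_norm ?_
      have i4 : 0 ≤ s ^ (1 + α) := Real.rpow_nonneg hs.1.le _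
      simpa [abs_mul, hc, abs_of_nonneg hz, abs_of_nonneg i4] using
        summable_negPhiDeriv ⟨h0, h1⟩ (z * s ^ (1 + α)) (mul_nonneg hz i4))
  rw [← key.tsum_eq, phiSeries, ← tsum_mul_left]
  refine tsum_congr fun n => ?_
  have hbeta := integral_rpow_mul_one_sub_rpow (a := (1 + α) * (n + 1)) (b := 1 - α)
    (by positivity) (by linarith)
  have e1 : ∫ s in (0:ℝ)..1, (1 - s) ^ (-α) * (s ^ α * (c n * (z * s ^ (1 + α)) ^ n)) =
      ∫ s in (0:ℝ)..1, (c n * z ^ n) *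
        (s ^ ((1 + α) * (n + 1) - 1) * (1 - s) ^ (1 - α - 1)) := by
    refine intervalIntegral.integral_congr_ae (ae_of_all _ fun s hs => ?_)
    rw [uIoc_of_le zero_le_one] at hs
    rw [mul_pow, ← Real.rpow_natCast (s ^ (1 + α)), ← Real.rpow_mul hs.1.le,
      show (1 + α) * ((n : ℝ) + 1) - 1 = α + (1 + α) * n by ring, Real.rpow_add hs.1,
      show 1 - α - 1 = -α by ring]
    ring
  rw [e1, intervalIntegral.integral_const_mul, hbeta]
  have hp : 0 < (1 + α) * ((n : ℝ) + 1) := by positivity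
  have g1 : Real.Gamma (α * (n + 1) + n + 2) =
      (1 + α) * (n + 1) * Real.Gamma ((1 + α) * (n + 1)) := by
    rw [← Real.Gamma_add_one hp.ne']; ring_nf
  have g2 : (1 + α) * ((n : ℝ) + 1) + (1 - α) = α * n + n + 2 := by ring
  have p1 : 0 < Real.Gamma ((1 + α) * (n + 1)) := Real.Gamma_pos_of_pos hp
  have p2 : 0 < Real.Gamma (α * n + n + 2) := Real.Gamma_pos_of_pos (by positivity)
  simp only [hc]
  rw [phiCoeff_succ, g1, g2]
  field_simp

/-- The Volterra equation on `[0, x]`. -/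
lemma integral_negPhiDeriv (hα : α ∈ Set.Ioo (0:ℝ) 1) {x : ℝ} (hx : 0 < x) :
    ∫ t in (0:ℝ)..x, (x - t) ^ (-α) * (t ^ α * negPhiDeriv α (t ^ (1 + α))) =
      Real.Gamma (1 - α) / (1 + α) * (x * phiSeries α (x ^ (1 + α))) := by
  have h := intervalIntegral.mul_integral_comp_mul_left (a := 0) (b := 1) (c := x)
    (f := fun t => (x - t) ^ (-α) * (t ^ α * negPhiDeriv α (t ^ (1 + α))))
  rw [mul_zero, mul_one] at h
  rw [← h, mul_left_comm, ← integral_negPhiDeriv_unit hα (Real.rpow_nonneg hx.le _)]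
  congr 1
  refine intervalIntegral.integral_congr_ae (ae_of_all _ fun s hs => ?_)
  rw [uIoc_of_le zero_le_one] at hs
  have hs1 : 0 ≤ 1 - s := by linarith [hs.2]
  have e : x ^ (-α) * x ^ α = 1 := by rw [← Real.rpow_add hx]; simp
  rw [show x - x * s = x * (1 - s) by ring, Real.mul_rpow hx.le hs1,
    Real.mul_rpow hx.le hs.1.le, Real.mul_rpow hx.le hs.1.le]
  linear_combination (1 - s) ^ (-α) * (s ^ α * negPhiDeriv α (x ^ (1 + α) * s ^ (1 + α))) * e

/-- At the first nonpositive value of `ψ`, the Abel-type integral `∫ (x - t)^(-α) ψ(t) dt`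
cannot have a positive derivative. -/
lemma not_pos_deriv_of_abel {α x₀ m : ℝ} {ψ M : ℝ → ℝ} (hα : α ∈ Set.Ioo (0:ℝ) 1)
    (hx₀ : 0 < x₀) (hψ : ContinuousOn ψ (Icc 0 x₀)) (hpos : ∀ t ∈ Ioo 0 x₀, 0 ≤ ψ t)
    (hψ₀ : ψ x₀ ≤ 0) (hd : DifferentiableAt ℝ ψ x₀)
    (hM : ∀ x ∈ Ioc 0 x₀, ∫ t in (0:ℝ)..x, (x - t) ^ (-α) * ψ t = M x)
    (hMd : HasDerivAt M m x₀) : m ≤ 0 := by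
  obtain ⟨h0, h1⟩ := hα
  obtain ⟨L, hLpos, hL⟩ := hd.isBigO_sub.exists_pos
  obtain ⟨δ, hδ, hball⟩ := Metric.eventually_nhds_iff.1 hL.bound
  have hint : ∀ a b x : ℝ, a ∈ Icc 0 x₀ → b ∈ Icc 0 x₀ →
      IntervalIntegrable (fun t => (x - t) ^ (-α) * ψ t) volume a b := by
    intro a b x ha hb
    refine IntervalIntegrable.mul_continuousOn ?_ (hψ.mono ?_)
    · have h := (intervalIntegral.intervalIntegrable_rpow' (a := x - a) (b := x - b) (r := -α)
        (by linarith)).comp_sub_left x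
      simpa using h
    · exact uIcc_subset_Icc ha hb
  have hupper : ∀ᶠ x in 𝓝[<] x₀, slope M x₀ x ≤ L * (x₀ - x) ^ (1 - α) := by
    have hmem : Ioo (max 0 (x₀ - δ)) x₀ ∈ 𝓝[<] x₀ :=
      Ioo_mem_nhdsLT (max_lt hx₀ (by linarith))
    filter_upwards [hmem] with x hx
    have hx1 : 0 < x := (le_max_left _ _).trans_lt hx.1
    have hx2 : x₀ - δ < x := (le_max_right _ _).trans_lt hx.1
    have hx3 : x < x₀ := hx.2
    have m0 : (0:ℝ) ∈ Icc 0 x₀ := ⟨le_rfl, hx₀.le⟩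
    have mx : x ∈ Icc 0 x₀ := ⟨hx1.le, hx3.le⟩
    have mx₀ : x₀ ∈ Icc 0 x₀ := ⟨hx₀.le, le_rfl⟩
    have hfirst : ∫ t in (0:ℝ)..x, (x₀ - t) ^ (-α) * ψ t ≤
        ∫ t in (0:ℝ)..x, (x - t) ^ (-α) * ψ t := by
      refine intervalIntegral.integral_mono_on_of_le_Ioo hx1.le (hint _ _ _ m0 mx)
        (hint _ _ _ m0 mx) fun t ht => ?_
      refine mul_le_mul_of_nonneg_right ?_ (hpos t ⟨ht.1, ht.2.trans hx3⟩)
      exact Real.rpow_le_rpow_of_nonpos (by linarith [ht.2]) (by linarith) (by linarith)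
    have hsecond : ∫ t in x..x₀, (x₀ - t) ^ (-α) * ψ t ≤
        ∫ _ in x..x₀, L * (x₀ - x) ^ (1 - α) := by
      refine intervalIntegral.integral_mono_on_of_le_Ioo hx3.le (hint _ _ _ mx mx₀)
        intervalIntegrable_const fun t ht => ?_
      have ht1 : 0 < x₀ - t := by linarith [ht.2]
      have hb := hball (y := t) (by
        rw [Real.dist_eq, abs_sub_comm, abs_of_pos ht1]; linarith [ht.1])
      rw [Real.norm_eq_abs, Real.norm_eq_abs, abs_sub_comm t, abs_of_pos ht1] at hb
      have hψt : ψ t ≤ L * (x₀ - t) := by linarith [le_abs_self (ψ t - ψ x₀)]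
      calc (x₀ - t) ^ (-α) * ψ t ≤ (x₀ - t) ^ (-α) * (L * (x₀ - t)) :=
            mul_le_mul_of_nonneg_left hψt (Real.rpow_nonneg ht1.le _)
        _ = L * (x₀ - t) ^ (1 - α) := by
            rw [sub_eq_neg_add 1 α, Real.rpow_add_one ht1.ne']; ring
        _ ≤ L * (x₀ - x) ^ (1 - α) := by
            refine mul_le_mul_of_nonneg_left ?_ hLpos.le
            exact Real.rpow_le_rpow ht1.le (by linarith [ht.1]) (by linarith)
    rw [intervalIntegral.integral_const, smul_eq_mul] at hsecond
    have hadd := intervalIntegral.integral_add_adjacent_intervals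
      (hint 0 x x₀ m0 mx) (hint x x₀ x₀ mx mx₀)
    rw [hM x₀ ⟨hx₀, le_rfl⟩] at hadd
    rw [hM x ⟨hx1, hx3.le⟩] at hfirst
    rw [slope_comm, slope_def_field, div_le_iff₀ (by linarith)]
    linarith
  have hslope : Tendsto (slope M x₀) (𝓝[<] x₀) (𝓝 m) :=
    (hasDerivAt_iff_tendsto_slope.1 hMd).mono_left
      (nhdsWithin_mono _ fun x hx => ne_of_lt hx)
  have hzero : Tendsto (fun x => L * (x₀ - x) ^ (1 - α)) (𝓝[<] x₀) (𝓝 0) := by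
    have hc : Continuous fun x => L * (x₀ - x) ^ (1 - α) :=
      continuous_const.mul ((continuous_const.sub continuous_id).rpow_const
        fun _ => Or.inr (by linarith))
    have h := (hc.tendsto x₀).mono_left (nhdsWithin_le_nhds (s := Iio x₀))
    simpa [Real.zero_rpow (by linarith : 1 - α ≠ 0)] using h
  exact le_of_tendsto_of_tendsto hslope hzero hupper

lemma negPhiDeriv_pos (hα : α ∈ Set.Ioo (0:ℝ) 1) {z : ℝ} (hz : 0 ≤ z) :
    0 < negPhiDeriv α z := by
  by_contra! hneg
  have h0 := hα.1
  have h1 := hα.2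
  have hcont := (differentiable_negPhiDeriv hα).continuous
  set S : Set ℝ := Ici 0 ∩ {w | negPhiDeriv α w ≤ 0}
  have hSclosed : IsClosed S := isClosed_Ici.inter (isClosed_le hcont continuous_const)
  have hSbdd : BddBelow S := ⟨0, fun w hw => hw.1⟩
  have hmem := hSclosed.csInf_mem ⟨z, hz, hneg⟩ hSbdd
  set z₀ := sInf S
  have hbelow : ∀ w, 0 ≤ w → w < z₀ → 0 < negPhiDeriv α w := fun w hw hlt => by
    by_contra! h
    exact absurd (csInf_le hSbdd ⟨hw, h⟩) (not_le.2 hlt)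
  have hz₀ : 0 < z₀ := lt_of_le_of_ne hmem.1 fun h => by
    have h2 := hmem.2
    rw [← h] at h2
    exact absurd (negPhiDeriv_zero_pos hα) (not_lt.2 h2)
  have hp : 0 < 1 + α := by linarith
  set x₀ := z₀ ^ (1 + α)⁻¹
  have hx₀ : 0 < x₀ := Real.rpow_pos_of_pos hz₀ _
  have hx₀z : x₀ ^ (1 + α) = z₀ := Real.rpow_inv_rpow hz₀.le hp.ne'
  set ψ : ℝ → ℝ := fun t => t ^ α * negPhiDeriv α (t ^ (1 + α))
  have hψpos : ∀ t ∈ Ioo 0 x₀, 0 < ψ t := fun t ht =>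
    mul_pos (Real.rpow_pos_of_pos ht.1 _) (hbelow _ (Real.rpow_nonneg ht.1.le _)
      (hx₀z ▸ Real.rpow_lt_rpow ht.1.le ht.2 hp))
  have hψcont : Continuous ψ :=
    (Real.continuous_rpow_const h0.le).mul (hcont.comp (Real.continuous_rpow_const hp.le))
  have hK : 0 < Real.Gamma (1 - α) / (1 + α) :=
    div_pos (Real.Gamma_pos_of_pos (by linarith)) hp
  have hVol := fun (x : ℝ) (hx : x ∈ Ioc 0 x₀) => integral_negPhiDeriv hα hx.1
  have hF : 0 < phiSeries α z₀ := by
    have hI : 0 < ∫ t in (0:ℝ)..x₀, (x₀ - t) ^ (-α) * ψ t := by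
      refine intervalIntegral.intervalIntegral_pos_of_pos_on ?_ (fun t ht => ?_) hx₀
      · have h := (intervalIntegral.intervalIntegrable_rpow' (a := x₀) (b := 0) (r := -α)
          (by linarith)).comp_sub_left x₀
        exact IntervalIntegrable.mul_continuousOn (by simpa using h) hψcont.continuousOn
      · exact mul_pos (Real.rpow_pos_of_pos (by linarith [ht.2]) _) (hψpos t ht)
    rw [hVol x₀ ⟨hx₀, le_rfl⟩, hx₀z] at hI
    exact pos_of_mul_pos_right (pos_of_mul_pos_right hI hK.le) hx₀.le
  have hψ₀ : negPhiDeriv α z₀ ≤ 0 := hmem.2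
  have hrpow : HasDerivAt (fun t : ℝ => t ^ (1 + α)) ((1 + α) * x₀ ^ (1 + α - 1)) x₀ :=
    Real.hasDerivAt_rpow_const (Or.inl hx₀.ne')
  have hd : DifferentiableAt ℝ ψ x₀ :=
    (Real.hasDerivAt_rpow_const (Or.inl hx₀.ne')).differentiableAt.mul
      ((differentiable_negPhiDeriv hα _).comp x₀ hrpow.differentiableAt)
  have hMd := ((hasDerivAt_id x₀).mul
    ((hasDerivAt_phiSeries hα (x₀ ^ (1 + α))).comp x₀ hrpow)).const_mul
      (Real.Gamma (1 - α) / (1 + α))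
  have hle := not_pos_deriv_of_abel hα hx₀ hψcont.continuousOn (fun t ht => (hψpos t ht).le)
    (mul_nonpos_of_nonneg_of_nonpos (Real.rpow_nonneg hx₀.le _) (by rwa [hx₀z])) hd hVol hMd
  refine absurd hle (not_le.2 (mul_pos hK ?_))
  simp only [Function.comp_apply, id, hx₀z, one_mul]
  have : 0 ≤ x₀ * (-negPhiDeriv α z₀ * ((1 + α) * x₀ ^ (1 + α - 1))) :=
    mul_nonneg hx₀.le (mul_nonneg (by linarith) (by positivity))
  linarith

lemma phiSeries_strictAntiOn (hα : α ∈ Set.Ioo (0:ℝ) 1) :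
    StrictAntiOn (phiSeries α) (Ici 0) := by
  refine strictAntiOn_of_deriv_neg (convex_Ici 0)
    (fun z _ => (hasDerivAt_phiSeries hα z).continuousAt.continuousWithinAt) fun z hz => ?_
  rw [interior_Ici] at hz
  rw [(hasDerivAt_phiSeries hα z).deriv]
  linarith [negPhiDeriv_pos hα (le_of_lt hz)]

end Series

/-- `Φ` is (strictly) decreasing on `[0,∞)`. -/
theorem Phi_strictAnti (α : ℝ) (hα : α ∈ Set.Ioo (0:ℝ) 1) :
    ∀ x₁ x₂ : ℝ, 0 ≤ x₁ → x₁ < x₂ → PhiF α x₂ < PhiF α x₁ := by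
  intro x₁ x₂ h₁ h₁₂
  have hp : 0 < 1 + α := by linarith [hα.1]
  have h₂ : 0 ≤ x₂ := h₁.trans h₁₂.le
  exact phiSeries_strictAntiOn hα (div_nonneg (Real.rpow_nonneg h₁ _) hp.le)
    (div_nonneg (Real.rpow_nonneg h₂ _) hp.le)
    (div_lt_div_of_pos_right (Real.rpow_lt_rpow h₁ h₁₂ hp) hp)
end

section
/- Let α ∈ (0,1). Then for every x > 0 one has 0 < x · Φ(x) ≤ 2. -/
open MeasureTheory Real Set
open Filter Topology

theorem integral_sub_rpow_mul_rpow {p q x : ℝ} (hp : -1 < p) (hq : -1 < q) (hx : 0 < x) :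
    ∫ s in (0:ℝ)..x, (x - s) ^ q * s ^ p =
      Gamma (p + 1) * Gamma (q + 1) / Gamma (p + q + 2) * x ^ (p + q + 1) := by
  have h := Complex.betaIntegral_scaled ((p + 1 : ℝ) : ℂ) ((q + 1 : ℝ) : ℂ) hx
  rw [Complex.betaIntegral_eq_Gamma_mul_div _ _ (by simp; linarith) (by simp; linarith)] at h
  apply Complex.ofReal_injective
  rw [← intervalIntegral.integral_ofReal]
  have e : ∫ s in (0:ℝ)..x, (((x - s) ^ q * s ^ p : ℝ) : ℂ) =
      ∫ s in (0:ℝ)..x, (s : ℂ) ^ (((p + 1 : ℝ) : ℂ) - 1) *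
        ((x : ℂ) - s) ^ (((q + 1 : ℝ) : ℂ) - 1) := by
    refine intervalIntegral.integral_congr fun s hs => ?_
    rw [uIcc_of_le hx.le] at hs
    simp only [Complex.ofReal_mul, Complex.ofReal_cpow (sub_nonneg.2 hs.2),
      Complex.ofReal_cpow hs.1]
    rw [mul_comm]
    push_cast
    simp
  rw [e, h, Complex.Gamma_ofReal, Complex.Gamma_ofReal, ← Complex.ofReal_add, Complex.Gamma_ofReal]
  rw [show p + 1 + (q + 1) = p + q + 2 by ring]
  rw [show ((p + q + 2 : ℝ) : ℂ) - 1 = ((p + q + 1 : ℝ) : ℂ) by push_cast; ring,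
    ← Complex.ofReal_cpow hx.le]
  push_cast
  ring

/-- Log-convexity bound for the growth of `Gamma`. -/
theorem sub_one_rpow_le_Gamma_add_div {a s : ℝ} (ha : 0 < a) (hs : 1 < s) :
    (s - 1) ^ a ≤ Gamma (s + a) / Gamma s := by
  have h := convexOn_log_Gamma.slope_mono_adjacent (x := s - 1) (y := s) (z := s + a)
    (by simpa using hs) (by simp; linarith) (by linarith) (by linarith)
  have hs0 : 0 < s - 1 := by linarith
  have e : Gamma s = (s - 1) * Gamma (s - 1) := by
    rw [← Gamma_add_one hs0.ne']; ring_nf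
  have h1 := Gamma_pos_of_pos hs0
  have h2 : 0 < Gamma s := Gamma_pos_of_pos (by linarith)
  have h3 : 0 < Gamma (s + a) := Gamma_pos_of_pos (by linarith)
  have e' : log (Gamma s) = log (s - 1) + log (Gamma (s - 1)) := by
    rw [e, log_mul hs0.ne' h1.ne']
  rw [← log_le_log_iff (by positivity) (by positivity), log_rpow hs0,
    log_div h3.ne' h2.ne']
  simp only [Function.comp_apply, sub_sub_cancel, div_one, add_sub_cancel_left] at h
  rw [le_div_iff₀ ha] at h
  nlinarith

/-- The Taylor coefficients of `z ↦ E_{α,1+1/α,1/α}(-z/(1+α))`. -/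
noncomputable def ksCoeff (α : ℝ) (n : ℕ) : ℝ :=
  (-1:ℝ)^n *
    (∏ i ∈ Finset.range n, Real.Gamma (α * i + i + 2) / Real.Gamma (α * (i+1) + i + 2)) /
    (1 + α) ^ n

/-- The entire function `z ↦ E_{α,1+1/α,1/α}(-z/(1+α))`. -/
noncomputable def ksSum (α z : ℝ) : ℝ := ∑' n : ℕ, ksCoeff α n * z ^ n

theorem PhiF_eq_ksSum (α x : ℝ) : PhiF α x = ksSum α (x ^ (1 + α)) := by
  unfold PhiF ksSum ksCoeff
  refine tsum_congr fun n => ?_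
  rw [div_pow]
  ring

theorem ksCoeff_zero (α : ℝ) : ksCoeff α 0 = 1 := by simp [ksCoeff]

theorem ksCoeff_succ (α : ℝ) (n : ℕ) :
    ksCoeff α (n + 1) = -(ksCoeff α n *
      (Gamma (α * n + n + 2) / Gamma (α * (n + 1) + n + 2)) / (1 + α)) := by
  simp only [ksCoeff, Finset.prod_range_succ, pow_succ, div_eq_mul_inv, mul_inv]
  ring

theorem ksCoeff_ne_zero {α : ℝ} (hα : 0 < α) (n : ℕ) : ksCoeff α n ≠ 0 := by
  unfold ksCoeff
  refine div_ne_zero (mul_ne_zero (by simp) (Finset.prod_ne_zero_iff.2 fun i _ => ?_))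
    (by positivity)
  exact div_ne_zero (Gamma_pos_of_pos (by positivity)).ne' (Gamma_pos_of_pos (by positivity)).ne'

theorem tendsto_norm_ksCoeff_succ_div {α : ℝ} (hα : 0 < α) :
    Tendsto (fun n ↦ ‖ksCoeff α n.succ‖ / ‖ksCoeff α n‖) atTop (𝓝 0) := by
  have hlim : Tendsto (fun n : ℕ => ((n : ℝ) ^ α)⁻¹) atTop (𝓝 0) :=
    tendsto_inv_atTop_zero.comp ((tendsto_rpow_atTop hα).comp tendsto_natCast_atTop_atTop)
  refine squeeze_zero' (Eventually.of_forall fun n => by positivity) ?_ hlim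
  filter_upwards [eventually_gt_atTop 0] with n hn
  have hn' : (0:ℝ) < n := by exact_mod_cast hn
  have h0 := norm_pos_iff.2 (ksCoeff_ne_zero hα n)
  have hG1 : 0 < Gamma (α * n + n + 2) := Gamma_pos_of_pos (by positivity)
  have hG2 : 0 < Gamma (α * (n + 1) + n + 2) := Gamma_pos_of_pos (by positivity)
  have hb := sub_one_rpow_le_Gamma_add_div (s := α * n + n + 2) hα
    (by nlinarith [mul_pos hα hn'])
  rw [show α * n + n + 2 + α = α * (n + 1) + n + 2 by ring] at hb
  have hn1 : (n : ℝ) ^ α ≤ (α * n + n + 2 - 1) ^ α :=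
    rpow_le_rpow hn'.le (by nlinarith [mul_pos hα hn']) hα.le
  rw [Nat.succ_eq_add_one, ksCoeff_succ, norm_neg, norm_div, norm_mul, norm_div,
    norm_of_nonneg hG1.le, norm_of_nonneg hG2.le, norm_of_nonneg (by positivity : 0 ≤ 1 + α)]
  calc _ = (Gamma (α * (n + 1) + n + 2) / Gamma (α * n + n + 2))⁻¹ / (1 + α) := by
        field_simp
    _ ≤ (Gamma (α * (n + 1) + n + 2) / Gamma (α * n + n + 2))⁻¹ :=
        div_le_self (by positivity) (by linarith)
    _ ≤ _ := inv_anti₀ (by positivity) (hn1.trans hb)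

theorem ksCoeff_radius {α : ℝ} (hα : 0 < α) :
    (FormalMultilinearSeries.ofScalars ℝ (ksCoeff α)).radius = ⊤ :=
  FormalMultilinearSeries.ofScalars_radius_eq_top_of_tendsto ℝ _
    (Eventually.of_forall (ksCoeff_ne_zero hα)) (tendsto_norm_ksCoeff_succ_div hα)

theorem summable_abs_ksCoeff_mul_pow {α : ℝ} (hα : 0 < α) {r : ℝ} (hr : 0 ≤ r) :
    Summable fun n => |ksCoeff α n| * r ^ n := by
  have h := (FormalMultilinearSeries.ofScalars ℝ (ksCoeff α)).summable_norm_mul_pow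
    (r := ⟨r, hr⟩) (by rw [ksCoeff_radius hα]; exact ENNReal.coe_lt_top)
  simp only [FormalMultilinearSeries.ofScalars_norm, norm_eq_abs] at h
  exact h

theorem hasSum_ksSum {α : ℝ} (hα : 0 < α) (z : ℝ) :
    HasSum (fun n => ksCoeff α n * z ^ n) (ksSum α z) := by
  refine Summable.hasSum (Summable.of_norm ?_)
  simpa [abs_mul] using summable_abs_ksCoeff_mul_pow hα (abs_nonneg z)

theorem differentiable_ksSum {α : ℝ} (hα : 0 < α) : Differentiable ℝ (ksSum α) := by
  have h := (FormalMultilinearSeries.ofScalars ℝ (ksCoeff α)).hasFPowerSeriesOnBall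
    (by rw [ksCoeff_radius hα]; exact ENNReal.zero_lt_top)
  rw [ksCoeff_radius hα] at h
  have e : (FormalMultilinearSeries.ofScalars ℝ (ksCoeff α)).sum = ksSum α := by
    funext z
    exact (FormalMultilinearSeries.ofScalars_sum_eq _ _).trans (by simp [ksSum])
  rw [e] at h
  have := h.differentiableOn
  intro z
  exact (this z (by simp)).differentiableAt (by simp)

theorem ksSum_zero (α : ℝ) : ksSum α 0 = 1 := by
  unfold ksSum
  rw [tsum_eq_single 0 (fun n hn => by simp [hn])]
  simp [ksCoeff_zero]

theorem intervalIntegrable_sub_rpow {α : ℝ} (hα : α < 1) (x a b : ℝ) :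
    IntervalIntegrable (fun s => (x - s) ^ (-α)) volume a b := by
  have h := (intervalIntegral.intervalIntegrable_rpow' (a := x - a) (b := x - b) (r := -α)
    (by linarith)).comp_sub_left x
  simpa using h

theorem integral_sub_rpow {α x : ℝ} (hα : α < 1) :
    ∫ s in (0:ℝ)..x, (x - s) ^ (-α) = x ^ (1 - α) / (1 - α) := by
  rw [intervalIntegral.integral_comp_sub_left (fun s => s ^ (-α)) x,
    integral_rpow (Or.inl (by linarith)), sub_self, sub_zero,
    show -α + 1 = 1 - α by ring, zero_rpow (by linarith), sub_zero]

theorem continuous_ksSum_comp {α : ℝ} (hα : 0 < α) (c : ℝ) :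
    Continuous fun s : ℝ => ksSum α (c * s ^ (1 + α)) :=
  (differentiable_ksSum hα).continuous.comp
    (continuous_const.mul (continuous_id.rpow_const fun _ => Or.inr (by linarith)))

theorem differentiableAt_ksSum_comp {α : ℝ} (hα : 0 < α) (c : ℝ) {t : ℝ} (ht : 0 < t) :
    DifferentiableAt ℝ (fun s : ℝ => ksSum α (c * s ^ (1 + α))) t :=
  ((differentiable_ksSum hα) _).comp t
    ((differentiableAt_id.rpow_const (Or.inl ht.ne')).const_mul c)

/-- Termwise integration of `s ↦ ksSum α (c * s ^ (1 + α))` against an integrable weight. -/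
theorem hasSum_integral_mul_ksSum {α : ℝ} (hα : 0 < α) {w : ℝ → ℝ} {x c : ℝ} (hx : 0 < x)
    (hc : 0 ≤ c) (hw : IntervalIntegrable w volume 0 x) :
    HasSum (fun n : ℕ => ksCoeff α n * c ^ n * ∫ s in (0:ℝ)..x, w s * s ^ ((1 + α) * n))
      (∫ s in (0:ℝ)..x, w s * ksSum α (c * s ^ (1 + α))) := by
  have hpow : ∀ n : ℕ, Continuous fun s : ℝ => s ^ ((1 + α) * n) := fun n =>
    continuous_id.rpow_const fun _ => Or.inr (by positivity)
  have hR : 0 ≤ c * x ^ (1 + α) := by positivity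
  have hsum := summable_abs_ksCoeff_mul_pow hα hR
  have key := intervalIntegral.hasSum_integral_of_dominated_convergence
    (μ := volume) (a := 0) (b := x)
    (F := fun (n : ℕ) s => ksCoeff α n * c ^ n * (w s * s ^ ((1 + α) * n)))
    (f := fun s => w s * ksSum α (c * s ^ (1 + α)))
    (fun n s => |w s| * (|ksCoeff α n| * (c * x ^ (1 + α)) ^ n)) ?_ ?_ ?_ ?_ ?_
  · simpa only [intervalIntegral.integral_const_mul] using key
  · intro n
    have h1 := hw.aestronglyMeasurable
    rw [uIoc_of_le hx.le]
    exact (h1.mul (hpow n).aestronglyMeasurable).const_mul _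
  · refine fun n => Eventually.of_forall fun s hs => ?_
    rw [uIoc_of_le hx.le] at hs
    have hs1 : s ^ ((1 + α) * n) ≤ (x ^ (1 + α)) ^ n := by
      rw [rpow_mul hs.1.le, rpow_natCast]
      exact pow_le_pow_left₀ (rpow_nonneg hs.1.le _) (rpow_le_rpow hs.1.le hs.2 (by linarith)) n
    have hs0 : 0 ≤ s ^ ((1 + α) * n) := rpow_nonneg hs.1.le _
    rw [norm_eq_abs, abs_mul, abs_mul, abs_mul, abs_of_nonneg hs0, abs_of_nonneg (pow_nonneg hc n),
      mul_pow]
    calc _ = |w s| * (|ksCoeff α n| * (c ^ n * s ^ ((1 + α) * n))) := by ring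
      _ ≤ _ := by gcongr
  · exact Eventually.of_forall fun s _ => hsum.mul_left _
  · simp_rw [tsum_mul_left]
    exact hw.abs.mul_const _
  · refine Eventually.of_forall fun s hs => ?_
    rw [uIoc_of_le hx.le] at hs
    refine ((hasSum_ksSum hα (c * s ^ (1 + α))).mul_left (w s)).congr_fun ?_
    intro n
    rw [mul_pow, rpow_mul hs.1.le, rpow_natCast]
    ring

/-- The fractional differential equation satisfied by `u s = ksSum α (c * s ^ (1 + α))`: its Caputo
derivative is `-(c / (1 + α)) * s * u s`. Here both sides are integrated and scaled by
`Gamma (1 - α)`. -/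
theorem integral_sub_rpow_mul_ksSum_sub_one {α : ℝ} (hα : α ∈ Ioo (0:ℝ) 1) {c x : ℝ} (hc : 0 ≤ c)
    (hx : 0 < x) :
    ∫ s in (0:ℝ)..x, (x - s) ^ (-α) * (ksSum α (c * s ^ (1 + α)) - 1) =
      ∫ s in (0:ℝ)..x, -(Gamma (1 - α) / (1 + α) * c) * (s * ksSum α (c * s ^ (1 + α))) := by
  obtain ⟨hα0, hα1⟩ := hα
  have hw := intervalIntegrable_sub_rpow hα1 x 0 x
  have h1 := hasSum_integral_mul_ksSum hα0 hx hc hw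
  have h2 := hasSum_integral_mul_ksSum hα0 hx hc
    (continuous_id.intervalIntegrable (μ := volume) 0 x)
  have h1' := (hasSum_nat_add_iff' 1).2 h1
  have h2' := h2.mul_left (-(Gamma (1 - α) / (1 + α) * c))
  simp only [id] at h2'
  simp_rw [mul_sub, mul_one]
  rw [intervalIntegral.integral_sub
    (hw.mul_continuousOn (continuous_ksSum_comp hα0 c).continuousOn) hw,
    intervalIntegral.integral_const_mul]
  simp only [Finset.sum_range_one, ksCoeff_zero, pow_zero, Nat.cast_zero, mul_zero, rpow_zero,
    mul_one, one_mul] at h1'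
  refine h1'.unique (h2'.congr_fun fun n => ?_)
  have hn : (0:ℝ) ≤ n := n.cast_nonneg
  have hαn : 0 ≤ α * n := by positivity
  rw [integral_sub_rpow_mul_rpow (by push_cast; nlinarith) (by linarith) hx]
  have e : ∫ s in (0:ℝ)..x, s * s ^ ((1 + α) * n) =
      x ^ ((1 + α) * n + 2) / ((1 + α) * n + 2) := by
    have : ∫ s in (0:ℝ)..x, s * s ^ ((1 + α) * n) = ∫ s in (0:ℝ)..x, s ^ ((1 + α) * n + 1) := by
      refine intervalIntegral.integral_congr fun s hs => ?_
      rw [uIcc_of_le hx.le] at hs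
      rw [rpow_add_one' hs.1 (by positivity), mul_comm]
    rw [this, integral_rpow (Or.inl (by nlinarith)), add_assoc,
      zero_rpow (by positivity)]
    norm_num
  rw [e, ksCoeff_succ]
  push_cast
  rw [show (1 + α) * ((n:ℝ) + 1) + -α + 2 = (α * n + n + 2) + 1 by ring,
    show (1 + α) * ((n:ℝ) + 1) + -α + 1 = (1 + α) * n + 2 by ring,
    show (1 + α) * ((n:ℝ) + 1) + 1 = α * (n + 1) + n + 2 by ring,
    show -α + 1 = 1 - α by ring, Gamma_add_one (by positivity)]
  have hG1 : 0 < Gamma (α * n + n + 2) := Gamma_pos_of_pos (by positivity)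
  have hG2 : 0 < Gamma (α * (n + 1) + n + 2) := Gamma_pos_of_pos (by positivity)
  rw [show (1 + α) * (n:ℝ) + 2 = α * n + n + 2 by ring]
  have : 0 < α * n + n + 2 := by positivity
  field_simp
  ring

/-- At a minimum `t` of a function on `[0, t]` lying strictly below its initial value, its Caputo
derivative is negative. -/
theorem caputo_neg_of_isMin {α t : ℝ} (hα : α ∈ Ioo (0:ℝ) 1) (ht : 0 < t) {d f : ℝ → ℝ}
    (hd : Continuous d) (hf : Continuous f) (hdt : DifferentiableAt ℝ d t)
    (hdf : ∀ x > 0, ∫ s in (0:ℝ)..x, (x - s) ^ (-α) * (d s - d 0) = ∫ s in (0:ℝ)..x, f s)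
    (hmin : ∀ s ∈ Icc 0 t, d t ≤ d s) (hlt : d t < d 0) : f t < 0 := by
  obtain ⟨hα0, hα1⟩ := hα
  have hint : ∀ x a b, IntervalIntegrable (fun s => (x - s) ^ (-α) * (d s - d t)) volume a b :=
    fun x a b => (intervalIntegrable_sub_rpow hα1 x a b).mul_continuousOn
      (hd.sub continuous_const).continuousOn
  set J : ℝ → ℝ := fun x => ∫ s in (0:ℝ)..x, (x - s) ^ (-α) * (d s - d t) with hJ
  have hJeq : J =ᶠ[𝓝 t] fun x =>
      (∫ s in (0:ℝ)..x, f s) + (d 0 - d t) / (1 - α) * x ^ (1 - α) := by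
    filter_upwards [eventually_gt_nhds ht] with x hx
    have hw := intervalIntegrable_sub_rpow hα1 x 0 x
    rw [← hdf x hx, show (d 0 - d t) / (1 - α) * x ^ (1 - α) =
      ∫ s in (0:ℝ)..x, (x - s) ^ (-α) * (d 0 - d t) by
        rw [intervalIntegral.integral_mul_const, integral_sub_rpow hα1]; ring,
      ← intervalIntegral.integral_add
        (hw.mul_continuousOn (g := fun s => d s - d 0) (hd.sub continuous_const).continuousOn)
        (hw.mul_const _)]
    refine intervalIntegral.integral_congr fun s _ => ?_
    ring
  have hderiv : HasDerivAt J (f t + (d 0 - d t) * t ^ (-α)) t := by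
    refine HasDerivAt.congr_of_eventuallyEq ?_ hJeq
    have h1 := intervalIntegral.integral_hasDerivAt_right (hf.intervalIntegrable (μ := volume) 0 t)
      (hf.stronglyMeasurableAtFilter _ _) hf.continuousAt
    have h2 := (hasDerivAt_rpow_const (p := 1 - α) (Or.inl ht.ne')).const_mul
      ((d 0 - d t) / (1 - α))
    refine (h1.add h2).congr_deriv ?_
    have : 1 - α ≠ 0 := by linarith
    rw [show 1 - α - 1 = -α by ring]
    field_simp
  obtain ⟨L, hL⟩ := hdt.hasDerivAt.isBigO_sub.bound
  obtain ⟨ε, hε, hball⟩ := Metric.eventually_nhds_iff.1 hL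
  have hslope : ∀ᶠ y in 𝓝[<] t, slope J t y ≤ max L 0 * (t - y) ^ (1 - α) := by
    have hy0 : ∀ᶠ y in 𝓝[<] t, max 0 (t - ε) < y :=
      eventually_nhdsWithin_of_eventually_nhds (eventually_gt_nhds (max_lt ht (by linarith)))
    filter_upwards [hy0, self_mem_nhdsWithin] with y hy hyt
    obtain ⟨hy0, hyε⟩ := max_lt_iff.1 hy
    have hyt' : 0 < t - y := sub_pos.2 hyt
    have hsplit : J t = (∫ s in (0:ℝ)..y, (t - s) ^ (-α) * (d s - d t)) +
        ∫ s in y..t, (t - s) ^ (-α) * (d s - d t) :=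
      (intervalIntegral.integral_add_adjacent_intervals (hint _ _ _) (hint _ _ _)).symm
    have hfst : (∫ s in (0:ℝ)..y, (t - s) ^ (-α) * (d s - d t)) ≤ J y := by
      refine intervalIntegral.integral_mono_on_of_le_Ioo hy0.le (hint _ _ _) (hint _ _ _) ?_
      intro s hs
      refine mul_le_mul_of_nonneg_right ?_ (sub_nonneg.2 (hmin s ⟨hs.1.le, (hs.2.trans hyt).le⟩))
      exact rpow_le_rpow_of_nonpos (sub_pos.2 hs.2) (sub_le_sub_right (le_of_lt hyt) s)
        (by linarith)
    have hsnd : (∫ s in y..t, (t - s) ^ (-α) * (d s - d t)) ≤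
        (t - y) * (max L 0 * (t - y) ^ (1 - α)) := by
      have hc : ∫ _ in y..t, max L 0 * (t - y) ^ (1 - α) =
          (t - y) * (max L 0 * (t - y) ^ (1 - α)) := by
        rw [intervalIntegral.integral_const, smul_eq_mul]
      rw [← hc]
      refine intervalIntegral.integral_mono_on_of_le_Ioo (le_of_lt hyt) (hint _ _ _)
        intervalIntegrable_const ?_
      intro s hs
      have hts : 0 < t - s := sub_pos.2 hs.2
      have hs' := hball (y := s) (by
        rw [dist_comm, dist_eq, abs_of_pos hts]; linarith [hs.1])
      have hds : d s - d t ≤ max L 0 * (t - s) := by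
        rw [norm_eq_abs, norm_eq_abs, abs_sub_comm s t, abs_of_pos hts] at hs'
        exact (le_abs_self _).trans (hs'.trans (by gcongr; exact le_max_left _ _))
      calc (t - s) ^ (-α) * (d s - d t) ≤ (t - s) ^ (-α) * (max L 0 * (t - s)) := by gcongr
        _ = max L 0 * (t - s) ^ (1 - α) := by
          rw [show 1 - α = -α + 1 by ring, rpow_add_one hts.ne']; ring
        _ ≤ _ := by
          refine mul_le_mul_of_nonneg_left ?_ (le_max_right _ _)
          exact rpow_le_rpow hts.le (by linarith [hs.1]) (by linarith)
    rw [slope_comm, slope_def_field, div_le_iff₀ hyt']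
    linarith
  have hlim : Tendsto (fun y => max L 0 * (t - y) ^ (1 - α)) (𝓝[<] t) (𝓝 0) := by
    have hcont : Continuous fun y : ℝ => max L 0 * (t - y) ^ (1 - α) :=
      continuous_const.mul ((continuous_const.sub continuous_id).rpow_const
        fun _ => Or.inr (by linarith))
    have h := hcont.tendsto t
    simp only [sub_self, zero_rpow (by linarith : 1 - α ≠ 0), mul_zero] at h
    exact h.mono_left nhdsWithin_le_nhds
  have hle : f t + (d 0 - d t) * t ^ (-α) ≤ 0 :=
    le_of_tendsto_of_tendsto
      ((hasDerivAt_iff_tendsto_slope.1 hderiv).mono_left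
        (nhdsWithin_mono t (s := Iio t) fun y (hy : y < t) => hy.ne)) hlim hslope
  have : 0 < (d 0 - d t) * t ^ (-α) := mul_pos (sub_pos.2 hlt) (rpow_pos_of_pos ht _)
  linarith

/-- Weak maximum principle for the Caputo derivative. -/
theorem lt_of_caputo_nonneg {α m : ℝ} (hα : α ∈ Ioo (0:ℝ) 1) {d f : ℝ → ℝ}
    (hd : Continuous d) (hf : Continuous f) (hdiff : ∀ t > 0, DifferentiableAt ℝ d t)
    (hdf : ∀ x > 0, ∫ s in (0:ℝ)..x, (x - s) ^ (-α) * (d s - d 0) = ∫ s in (0:ℝ)..x, f s)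
    (hm : m < d 0) (hfm : ∀ t > 0, d t ≤ m → 0 ≤ f t) {x : ℝ} (hx : 0 ≤ x) : m < d x := by
  by_contra! hxm
  obtain ⟨t, ht, hmin⟩ := isCompact_Icc.exists_isMinOn (nonempty_Icc.2 hx) hd.continuousOn
  have htm : d t ≤ m := (hmin (right_mem_Icc.2 hx)).trans hxm
  have ht0 : 0 < t := by
    refine lt_of_le_of_ne ht.1 fun h => ?_
    rw [← h] at htm
    linarith
  have := caputo_neg_of_isMin hα ht0 hd hf (hdiff t ht0) hdf
    (fun s hs => hmin ⟨hs.1, hs.2.trans ht.2⟩) (by linarith)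
  linarith [hfm t ht0 htm]

theorem ksSum_pos {α z : ℝ} (hα : α ∈ Ioo (0:ℝ) 1) (hz : 0 ≤ z) : 0 < ksSum α z := by
  have hα0 : 0 < 1 + α := by linarith [hα.1]
  have h0 : ksSum α (1 * (0:ℝ) ^ (1 + α)) = 1 := by rw [zero_rpow hα0.ne', mul_zero, ksSum_zero]
  have hK : 0 < Gamma (1 - α) := Gamma_pos_of_pos (by linarith [hα.2])
  have hc := continuous_ksSum_comp hα.1 1
  have h := lt_of_caputo_nonneg (m := 0)
    (f := fun s => -(Gamma (1 - α) / (1 + α) * 1) * (s * ksSum α (1 * s ^ (1 + α)))) hα hc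
    (continuous_const.mul (continuous_id.mul hc)) (fun t ht => differentiableAt_ksSum_comp hα.1 1 ht)
    (fun x hx => by
      rw [h0]
      exact integral_sub_rpow_mul_ksSum_sub_one hα zero_le_one hx)
    (by rw [h0]; exact one_pos)
    (fun t ht hle => by
      rw [neg_mul, Right.nonneg_neg_iff]
      exact mul_nonpos_of_nonneg_of_nonpos (by positivity)
        (mul_nonpos_of_nonneg_of_nonpos ht.le hle))
    (x := z ^ (1 + α)⁻¹) (by positivity)
  rwa [rpow_inv_rpow hz hα0.ne', one_mul] at h

theorem ksSum_antitoneOn {α : ℝ} (hα : α ∈ Ioo (0:ℝ) 1) : AntitoneOn (ksSum α) (Ici 0) := by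
  have hα0 : 0 < 1 + α := by linarith [hα.1]
  have h0 : ∀ c, ksSum α (c * (0:ℝ) ^ (1 + α)) = 1 := fun c => by
    rw [zero_rpow hα0.ne', mul_zero, ksSum_zero]
  have hK : 0 < Gamma (1 - α) := Gamma_pos_of_pos (by linarith [hα.2])
  have hcont := continuous_ksSum_comp hα.1
  suffices H : ∀ c ≥ 1, ∀ z > 0, ksSum α (c * z) ≤ ksSum α z by
    intro a ha b hb hab
    rcases (mem_Ici.1 ha).eq_or_lt with rfl | ha'
    · rcases (mem_Ici.1 hb).eq_or_lt with rfl | hb'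
      · exact le_rfl
      · have hlim : Tendsto (fun ε : ℝ => ksSum α ε) (𝓝[>] 0) (𝓝 (ksSum α 0)) :=
          ((differentiable_ksSum hα.1).continuous.tendsto 0).mono_left nhdsWithin_le_nhds
        refine ge_of_tendsto hlim ?_
        filter_upwards [Ioo_mem_nhdsGT hb'] with ε hε
        have := H (b / ε) ((one_le_div hε.1).2 hε.2.le) ε hε.1
        rwa [div_mul_cancel₀ _ hε.1.ne'] at this
    · have := H (b / a) ((one_le_div ha').2 hab) a ha'
      rwa [div_mul_cancel₀ _ ha'.ne'] at this
  intro c hc z hz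
  have hc0 : 0 ≤ c := zero_le_one.trans hc
  rw [← sub_nonneg]
  refine le_of_forall_lt fun m hm => ?_
  have hint : ∀ x c, IntervalIntegrable
      (fun s => (x - s) ^ (-α) * (ksSum α (c * s ^ (1 + α)) - 1)) volume 0 x := fun x c =>
    (intervalIntegrable_sub_rpow hα.2 x 0 x).mul_continuousOn
      ((hcont c).sub continuous_const).continuousOn
  have hf : ∀ c, Continuous fun s =>
      -(Gamma (1 - α) / (1 + α) * c) * (s * ksSum α (c * s ^ (1 + α))) := fun c =>
    continuous_const.mul (continuous_id.mul (hcont c))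
  have h := lt_of_caputo_nonneg (m := m)
    (d := fun s => ksSum α (1 * s ^ (1 + α)) - ksSum α (c * s ^ (1 + α)))
    (f := fun s => -(Gamma (1 - α) / (1 + α) * 1) * (s * ksSum α (1 * s ^ (1 + α))) -
      -(Gamma (1 - α) / (1 + α) * c) * (s * ksSum α (c * s ^ (1 + α))))
    hα ((hcont 1).sub (hcont c)) ((hf 1).sub (hf c))
    (fun t ht => (differentiableAt_ksSum_comp hα.1 1 ht).sub
      (differentiableAt_ksSum_comp hα.1 c ht))
    (fun x hx => by
      rw [intervalIntegral.integral_sub ((hf 1).intervalIntegrable _ _)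
        ((hf c).intervalIntegrable _ _), ← integral_sub_rpow_mul_ksSum_sub_one hα zero_le_one hx,
        ← integral_sub_rpow_mul_ksSum_sub_one hα hc0 hx,
        ← intervalIntegral.integral_sub (hint x 1) (hint x c)]
      refine intervalIntegral.integral_congr fun s _ => ?_
      simp only [h0]
      ring)
    (by simpa only [h0, sub_self] using hm)
    (fun t ht hle => by
      have hpos := ksSum_pos hα (z := c * t ^ (1 + α)) (by positivity)
      have h1 : ksSum α (1 * t ^ (1 + α)) ≤ c * ksSum α (c * t ^ (1 + α)) := by nlinarith
      have hA : 0 ≤ Gamma (1 - α) / (1 + α) * t := by positivity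
      have := mul_nonneg hA (sub_nonneg.2 h1)
      linarith)
    (x := z ^ (1 + α)⁻¹) (by positivity)
  simpa only [rpow_inv_rpow hz.le hα0.ne', one_mul] using h

theorem two_rpow_neg_le_Gamma_two_sub {α : ℝ} (hα : α ∈ Ioo (0:ℝ) 1) :
    (2:ℝ) ^ (-α) ≤ Gamma (2 - α) := by
  obtain ⟨hα0, hα1⟩ := hα
  have h := convexOn_log_Gamma.slope_mono_adjacent (x := 2 - α) (y := 2) (z := 3)
    (by simp; linarith) (by simp) (by linarith) (by norm_num)
  have h3 : Gamma 3 = 2 := by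
    rw [show (3:ℝ) = 2 + 1 by norm_num, Gamma_add_one two_ne_zero, Gamma_two, mul_one]
  have hG : 0 < Gamma (2 - α) := Gamma_pos_of_pos (by linarith)
  rw [← log_le_log_iff (by positivity) hG, log_rpow two_pos]
  simp only [Function.comp_apply, Gamma_two, log_one, h3, sub_sub_cancel] at h
  rw [div_le_iff₀ hα0] at h
  norm_num at h
  linarith

theorem ksSum_rpow_mul_le {α x : ℝ} (hα : α ∈ Ioo (0:ℝ) 1) (hx : 0 < x) :
    Gamma (2 - α) / (2 * (1 + α)) * x ^ (1 + α) * ksSum α (x ^ (1 + α)) ≤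
      1 - ksSum α (x ^ (1 + α)) := by
  have hα0 : 0 < 1 + α := by linarith [hα.1]
  have hα1 : 0 < 1 - α := by linarith [hα.2]
  have hcont := continuous_ksSum_comp hα.1 1
  have hanti : ∀ s ∈ Icc 0 x, ksSum α (x ^ (1 + α)) ≤ ksSum α (1 * s ^ (1 + α)) := fun s hs => by
    rw [one_mul]
    exact ksSum_antitoneOn hα (rpow_nonneg hs.1 _) (rpow_nonneg hx.le _)
      (rpow_le_rpow hs.1 hs.2 hα0.le)
  have h := integral_sub_rpow_mul_ksSum_sub_one hα zero_le_one hx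
  rw [intervalIntegral.integral_const_mul] at h
  set u := ksSum α (x ^ (1 + α)) with hu
  have hw := intervalIntegrable_sub_rpow hα.2 x 0 x
  have h1 : (u - 1) * (x ^ (1 - α) / (1 - α)) ≤
      ∫ s in (0:ℝ)..x, (x - s) ^ (-α) * (ksSum α (1 * s ^ (1 + α)) - 1) := by
    rw [← integral_sub_rpow hα.2, mul_comm, ← intervalIntegral.integral_mul_const]
    refine intervalIntegral.integral_mono_on hx.le (hw.mul_const _)
      (hw.mul_continuousOn (hcont.sub continuous_const).continuousOn) fun s hs => ?_
    exact mul_le_mul_of_nonneg_left (by linarith [hanti s hs]) (rpow_nonneg (sub_nonneg.2 hs.2) _)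
  have h2 : x ^ 2 / 2 * u ≤ ∫ s in (0:ℝ)..x, s * ksSum α (1 * s ^ (1 + α)) := by
    have e : ∫ s in (0:ℝ)..x, s * u = x ^ 2 / 2 * u := by
      rw [intervalIntegral.integral_mul_const, integral_id]; ring
    rw [← e]
    refine intervalIntegral.integral_mono_on hx.le
      ((continuous_id.mul continuous_const).intervalIntegrable _ _)
      ((continuous_id.mul hcont).intervalIntegrable _ _) fun s hs => ?_
    exact mul_le_mul_of_nonneg_left (hanti s hs) hs.1
  have hK : 0 < Gamma (1 - α) := Gamma_pos_of_pos hα1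
  have hG : Gamma (2 - α) = (1 - α) * Gamma (1 - α) := by
    rw [← Gamma_add_one hα1.ne']; ring_nf
  have h3 : Gamma (1 - α) / (1 + α) * 1 * (x ^ 2 / 2 * u) ≤
      (1 - u) * (x ^ (1 - α) / (1 - α)) := by
    have := mul_le_mul_of_nonneg_left h2
      (by positivity : 0 ≤ Gamma (1 - α) / (1 + α) * 1)
    linarith
  have hxx : x ^ 2 = x ^ (1 - α) * x ^ (1 + α) := by
    rw [← rpow_add hx, ← rpow_natCast]; norm_num
  have hpos : 0 < x ^ (1 - α) / (1 - α) := by positivity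
  refine le_of_mul_le_mul_right (le_of_eq_of_le ?_ h3) hpos
  rw [hG, hxx]
  field_simp

theorem mul_ksSum_rpow_le_two {α x : ℝ} (hα : α ∈ Ioo (0:ℝ) 1) (hx : 0 < x) :
    x * ksSum α (x ^ (1 + α)) ≤ 2 := by
  have hα0 : 0 < 1 + α := by linarith [hα.1]
  have h := ksSum_rpow_mul_le hα hx
  have hu := ksSum_pos hα (rpow_nonneg hx.le (1 + α))
  set u := ksSum α (x ^ (1 + α))
  have hB := one_add_mul_self_le_rpow_one_add (s := x / 2 - 1) (by linarith) (p := 1 + α)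
    (by linarith [hα.1])
  rw [add_sub_cancel, div_rpow hx.le zero_le_two] at hB
  have hG := two_rpow_neg_le_Gamma_two_sub hα
  have hxp : 0 < x ^ (1 + α) := rpow_pos_of_pos hx _
  have h2 : x ^ (1 + α) / 2 ^ (1 + α) / (1 + α) ≤
      Gamma (2 - α) / (2 * (1 + α)) * x ^ (1 + α) := by
    have e : (2:ℝ) ^ (1 + α) = 2 / 2 ^ (-α) := by
      rw [rpow_neg zero_le_two, div_inv_eq_mul, rpow_add two_pos, rpow_one]
    have : (0:ℝ) < 2 ^ (-α) := by positivity
    rw [e]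
    calc _ = (2:ℝ) ^ (-α) / (2 * (1 + α)) * x ^ (1 + α) := by field_simp
      _ ≤ _ := by gcongr
  have h3 : 1 / (1 + α) + (x / 2 - 1) ≤ x ^ (1 + α) / 2 ^ (1 + α) / (1 + α) := by
    rw [le_div_iff₀ hα0]
    refine le_of_eq_of_le ?_ hB
    field_simp
  have h4 := mul_le_mul_of_nonneg_right (h3.trans h2) hu.le
  have h5 : 0 < 1 / (1 + α) * u := by positivity
  linarith

/-- for every `x > 0` one has `0 < x Φ(x) ≤ 2`. -/
theorem xPhi_bounds (α : ℝ) (hα : α ∈ Set.Ioo (0:ℝ) 1) :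
    ∀ x > (0:ℝ), 0 < x * PhiF α x ∧ x * PhiF α x ≤ 2 := by
  intro x hx
  rw [PhiF_eq_ksSum]
  exact ⟨mul_pos hx (ksSum_pos hα (rpow_nonneg hx.le _)), mul_ksSum_rpow_le_two hα hx⟩
end

section
/- Let α ∈ (0,1) and x₁ > 0. Let U ∈ C^{1+α}([0,∞)) and set u(x,t) = U(x t^{−1/(1+α)}). Suppose that ∂u/∂t − ∂/∂x (D^α_x u) > 0 at every point (x,t) with t ∈ (1,2) and 0 < x < x₁ t^{1/(1+α)}. Then U cannot attain its minimum over [0,x₁] at an interior point: the minimum of U over [0,x₁] equals min{U(0), U(x₁)}. -/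
open MeasureTheory Real Set

/-- Caputo fractional derivative of order `α` on the half-line:
`D^α u(x) = (1/Γ(1−α)) ∫₀ˣ u'(s)(x−s)^{−α} ds`. -/
noncomputable def caputo (α : ℝ) (u : ℝ → ℝ) (x : ℝ) : ℝ :=
  (1 / Real.Gamma (1 - α)) * ∫ s in (0:ℝ)..x, deriv u s * (x - s) ^ (-α)

lemma continuousAt_sub_rpow {c s : ℝ} (p : ℝ) (h : s < c) :
    ContinuousAt (fun s => (c - s) ^ p) s :=
  (continuousAt_const.sub (continuousAt_id' _)).rpow_const (Or.inl (sub_pos.2 h).ne')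

lemma integral_mul_rpow_sub_nonneg_of_min {α x₀ h : ℝ} (hα : α ∈ Set.Ioo (0:ℝ) 1)
    (hx₀ : 0 < x₀) (hh : 0 < h) {W : ℝ → ℝ} (hc : ContinuousOn W (Icc 0 x₀))
    (hd : ∀ s > 0, DifferentiableAt ℝ W s) (hV : ContinuousOn (deriv W) (Ici 0))
    (hmin : ∀ s ∈ Icc 0 x₀, W x₀ ≤ W s) :
    0 ≤ ∫ s in (0:ℝ)..x₀, deriv W s * ((x₀ + h - s) ^ (-α) - (x₀ - s) ^ (-α)) := by
  obtain ⟨hα0, hα1⟩ := hα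
  have hKint : IntervalIntegrable (fun s => (x₀ + h - s) ^ (-α) - (x₀ - s) ^ (-α))
      volume 0 x₀ := by
    refine IntervalIntegrable.sub ?_ ?_
    · refine ContinuousOn.intervalIntegrable fun s hs => ?_
      rw [uIcc_of_le hx₀.le] at hs
      exact (continuousAt_sub_rpow _ (by linarith [hs.2])).continuousWithinAt
    · have := (intervalIntegral.intervalIntegrable_rpow' (a := x₀) (b := 0)
        (by linarith : -1 < -α)).comp_sub_left x₀
      simpa using this
  have hφ := hKint.continuousOn_mul (g := deriv W) (hV.mono (by
    rw [uIcc_of_le hx₀.le]; exact Icc_subset_Ici_self))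
  have key := intervalIntegral.sub_le_integral_of_hasDeriv_right_of_le
    (g := fun s => (W s - W x₀) * ((x₀ + h - s) ^ (-α) - (x₀ - s) ^ (-α)))
    (g' := fun s => deriv W s * ((x₀ + h - s) ^ (-α) - (x₀ - s) ^ (-α))
      + (W s - W x₀) * (α * (x₀ + h - s) ^ (-α - 1) - α * (x₀ - s) ^ (-α - 1)))
    (φ := fun s => deriv W s * ((x₀ + h - s) ^ (-α) - (x₀ - s) ^ (-α)))
    hx₀.le ?_ ?_ ?_ ?_
  · refine le_trans ?_ key
    simp only [sub_self, zero_mul, zero_sub, sub_zero]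
    have h1 : (x₀ + h) ^ (-α) ≤ x₀ ^ (-α) :=
      Real.rpow_le_rpow_of_nonpos hx₀ (by linarith) (by linarith)
    have h2 := hmin 0 ⟨le_rfl, hx₀.le⟩
    nlinarith
  · intro s hs
    rcases hs.2.lt_or_eq with hlt | rfl
    · refine ((hc s hs).sub continuousWithinAt_const).mul
        (ContinuousAt.continuousWithinAt (ContinuousAt.sub ?_ ?_))
      · exact continuousAt_sub_rpow _ (by linarith)
      · exact continuousAt_sub_rpow _ (by linarith)
    · simp only [mul_sub]
      refine ContinuousWithinAt.sub ?_ ?_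
      · refine ((hc s hs).sub continuousWithinAt_const).mul (ContinuousAt.continuousWithinAt ?_)
        exact continuousAt_sub_rpow _ (by linarith)
      · obtain ⟨C, hC⟩ := (hd s hx₀).hasDerivAt.isBigO_sub.bound
        have hlim : Filter.Tendsto (fun y => C * (s - y) ^ (1 - α)) (nhds s) (nhds 0) := by
          have : ContinuousAt (fun y => C * (s - y) ^ (1 - α)) s :=
            continuousAt_const.mul ((continuousAt_const.sub (continuousAt_id' _)).rpow_const
              (Or.inr (by linarith)))
          simpa [ContinuousAt, Real.zero_rpow (by linarith : 1 - α ≠ 0)] using this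
        simp only [ContinuousWithinAt, sub_self, zero_mul]
        refine squeeze_zero_norm' ?_ (hlim.mono_left nhdsWithin_le_nhds)
        filter_upwards [nhdsWithin_le_nhds hC, self_mem_nhdsWithin] with y hy hy'
        rcases hy'.2.lt_or_eq with hlt | rfl
        · have hpos : 0 < s - y := by linarith
          have e : (s - y) ^ (1 - α) = (s - y) * (s - y) ^ (-α) := by
            rw [sub_eq_add_neg 1 α, Real.rpow_add hpos, Real.rpow_one]
          rw [norm_mul, Real.norm_of_nonneg (Real.rpow_nonneg hpos.le _), e, ← mul_assoc]
          refine mul_le_mul_of_nonneg_right ?_ (Real.rpow_nonneg hpos.le _)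
          rwa [← Real.norm_of_nonneg hpos.le, norm_sub_rev s y]
        · simp [Real.zero_rpow (by linarith : 1 - α ≠ 0)]
  · intro s hs
    have e1 : HasDerivAt (fun s => (x₀ + h - s) ^ (-α)) (α * (x₀ + h - s) ^ (-α - 1)) s := by
      have := ((hasDerivAt_id' s).const_sub (x₀ + h)).rpow_const (p := -α)
        (Or.inl (by linarith [hs.2]))
      convert this using 1
      ring
    have e2 : HasDerivAt (fun s => (x₀ - s) ^ (-α)) (α * (x₀ - s) ^ (-α - 1)) s := by
      have := ((hasDerivAt_id' s).const_sub x₀).rpow_const (p := -α)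
        (Or.inl (by linarith [hs.2]))
      convert this using 1
      ring
    exact (((hd s hs.1).hasDerivAt.sub_const _).mul (e1.sub e2)).hasDerivWithinAt
  · rwa [← intervalIntegrable_iff_integrableOn_Icc_of_le hx₀.le]
  · intro s hs
    have h1 : (x₀ + h - s) ^ (-α - 1) ≤ (x₀ - s) ^ (-α - 1) :=
      Real.rpow_le_rpow_of_nonpos (by linarith [hs.2]) (by linarith) (by linarith)
    have h2 := hmin s ⟨hs.1.le, hs.2.le⟩
    have h3 : 0 ≤ (W s - W x₀) * (α * ((x₀ - s) ^ (-α - 1) - (x₀ + h - s) ^ (-α - 1))) :=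
      mul_nonneg (by linarith) (mul_nonneg hα0.le (by linarith))
    linarith

lemma exists_integral_mul_rpow_nonneg_of_min {α x₀ H : ℝ} (hα : α ∈ Set.Ioo (0:ℝ) 1)
    (hx₀ : 0 < x₀) (hH : 0 < H) {W : ℝ → ℝ}
    (hd : ∀ s > 0, DifferentiableAt ℝ W s) (hV : ContinuousOn (deriv W) (Ici 0))
    (hmin : ∀ s ∈ Icc x₀ (x₀ + H), W x₀ ≤ W s) :
    ∃ h ∈ Ioo 0 H, 0 ≤ ∫ θ in (0:ℝ)..1, deriv W (x₀ + h * θ) * (1 - θ) ^ (-α) := by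
  obtain ⟨hα0, hα1⟩ := hα
  by_contra! hneg
  have hker : IntervalIntegrable (fun θ : ℝ => (1 - θ) ^ (-α)) volume 0 1 := by
    have := (intervalIntegral.intervalIntegrable_rpow' (a := 1) (b := 0)
      (by linarith : -1 < -α)).comp_sub_left 1
    simpa using this
  rw [intervalIntegrable_iff_integrableOn_Ioc_of_le zero_le_one] at hker
  obtain ⟨M, hM⟩ := (isCompact_Icc (a := x₀) (b := x₀ + H)).exists_bound_of_continuousOn
    (hV.mono fun s hs => hx₀.le.trans hs.1)
  have hinteg : Integrable (fun p : ℝ × ℝ => deriv W (x₀ + p.1 * p.2) * (1 - p.2) ^ (-α))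
      ((volume.restrict (Ioc 0 H)).prod (volume.restrict (Ioc 0 1))) := by
    have h1 : Integrable (fun p : ℝ × ℝ => (1 - p.2) ^ (-α))
        ((volume.restrict (Ioc 0 H)).prod (volume.restrict (Ioc 0 1))) := by
      exact hker.comp_snd _
    refine h1.bdd_mul (c := M) ?_ ?_
    · exact ((measurable_deriv W).comp (by fun_prop)).aestronglyMeasurable
    · rw [Measure.prod_restrict]
      filter_upwards [ae_restrict_mem (measurableSet_Ioc.prod measurableSet_Ioc)] with p hp
      have := hp.1.1; have := hp.1.2; have := hp.2.1; have := hp.2.2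
      exact hM _ ⟨by nlinarith, by nlinarith⟩
  have hswap := integral_integral_swap
    (f := fun h θ => deriv W (x₀ + h * θ) * (1 - θ) ^ (-α)) hinteg
  have hleft : ∫ h in (0:ℝ)..H, (∫ θ in (0:ℝ)..1, deriv W (x₀ + h * θ) * (1 - θ) ^ (-α)) < 0 := by
    have hi : IntervalIntegrable
        (fun h => -∫ θ in (0:ℝ)..1, deriv W (x₀ + h * θ) * (1 - θ) ^ (-α)) volume 0 H := by
      rw [intervalIntegrable_iff_integrableOn_Ioc_of_le hH.le]
      simp only [intervalIntegral.integral_of_le zero_le_one]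
      exact hinteg.integral_prod_left.neg
    have := intervalIntegral.intervalIntegral_pos_of_pos_on hi
      (fun h hh => neg_pos.2 (hneg h hh)) hH
    rw [intervalIntegral.integral_neg] at this
    linarith
  rw [intervalIntegral.integral_of_le hH.le] at hleft
  simp only [intervalIntegral.integral_of_le zero_le_one] at hleft
  rw [hswap] at hleft
  refine hleft.not_ge (setIntegral_nonneg measurableSet_Ioc fun θ hθ => ?_)
  rw [integral_mul_const]
  refine mul_nonneg ?_ (Real.rpow_nonneg (by linarith [hθ.2]) _)
  rw [← intervalIntegral.integral_of_le hH.le]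
  have hpos : ∀ h ∈ uIcc 0 H, 0 < x₀ + h * θ := by
    intro h hh
    rw [uIcc_of_le hH.le] at hh
    have := mul_nonneg hh.1 hθ.1.le
    linarith
  have hFTC := intervalIntegral.integral_eq_sub_of_hasDerivAt (a := 0) (b := H)
    (f := fun h => W (x₀ + h * θ) / θ) (f' := fun h => deriv W (x₀ + h * θ)) ?_ ?_
  · rw [hFTC, ← sub_div]
    refine div_nonneg ?_ hθ.1.le
    have := mul_pos hH hθ.1
    have := hmin (x₀ + H * θ) ⟨by linarith, by nlinarith [hθ.2]⟩
    simpa using this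
  · intro h hh
    have h1 : HasDerivAt (fun h => x₀ + h * θ) θ h := by
      simpa using ((hasDerivAt_id h).mul_const θ).const_add x₀
    have := ((hd _ (hpos h hh)).hasDerivAt.comp h h1).div_const θ
    rwa [mul_div_cancel_right₀ _ hθ.1.ne'] at this
  · exact ContinuousOn.intervalIntegrable
      (hV.comp (by fun_prop) fun h hh => (hpos h hh).le)

lemma deriv_caputo_nonneg_of_min {α x₀ X : ℝ} (hα : α ∈ Set.Ioo (0:ℝ) 1)
    (hx₀ : 0 < x₀) (hX : x₀ < X) {W : ℝ → ℝ} (hc : ContinuousOn W (Ici 0))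
    (hd : ∀ s > 0, DifferentiableAt ℝ W s) (hV : ContinuousOn (deriv W) (Ici 0))
    (hmin : ∀ s ∈ Icc 0 X, W x₀ ≤ W s) :
    0 ≤ deriv (caputo α W) x₀ := by
  by_contra! hneg
  have hdiff : HasDerivAt (caputo α W) (deriv (caputo α W) x₀) x₀ :=
    (differentiableAt_of_deriv_ne_zero hneg.ne).hasDerivAt
  have hev : ∀ᶠ x in nhdsWithin x₀ (Ioi x₀), caputo α W x < caputo α W x₀ := by
    have h1 := (hasDerivWithinAt_iff_tendsto_slope' (by simp)).1
      (hdiff.hasDerivWithinAt (s := Ioi x₀))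
    filter_upwards [h1.eventually (gt_mem_nhds hneg), self_mem_nhdsWithin] with x hx hx'
    rw [slope_def_field, div_neg_iff] at hx
    have : x₀ < x := hx'
    rcases hx with ⟨_, h⟩ | ⟨h, _⟩ <;> linarith
  obtain ⟨b, hb, hbs⟩ := (mem_nhdsGT_iff_exists_Ioo_subset' hX).1 hev
  have hb' : x₀ < b := hb
  have hH : 0 < min b X - x₀ := by simp [hb', hX]
  obtain ⟨h, hh, hB⟩ := exists_integral_mul_rpow_nonneg_of_min hα hx₀ hH hd hV
    (fun s hs => hmin s ⟨hx₀.le.trans hs.1, by linarith [hs.2, min_le_right b X]⟩)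
  have hlt : caputo α W (x₀ + h) < caputo α W x₀ :=
    hbs ⟨by linarith [hh.1], by linarith [hh.2, min_le_left b X]⟩
  have hA := integral_mul_rpow_sub_nonneg_of_min hα hx₀ hh.1 (hc.mono Icc_subset_Ici_self) hd hV
    (fun s hs => hmin s ⟨hs.1, hs.2.trans hX.le⟩)
  have hG : 0 < 1 / Real.Gamma (1 - α) :=
    one_div_pos.2 (Real.Gamma_pos_of_pos (by linarith [hα.2]))
  have hlt' := lt_of_mul_lt_mul_left hlt hG.le
  have hinteg : ∀ x > 0, IntervalIntegrable (fun s => deriv W s * (x - s) ^ (-α)) volume 0 x := by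
    intro x hx
    have := (intervalIntegral.intervalIntegrable_rpow' (a := x) (b := 0)
      (by linarith [hα.2] : -1 < -α)).comp_sub_left x
    rw [sub_self, sub_zero] at this
    exact this.continuousOn_mul (hV.mono (by rw [uIcc_of_le hx.le]; exact Icc_subset_Ici_self))
  have hi := hinteg (x₀ + h) (by linarith [hh.1])
  have hi1 : IntervalIntegrable (fun s => deriv W s * (x₀ + h - s) ^ (-α)) volume 0 x₀ :=
    hi.mono_set (by
      rw [uIcc_of_le hx₀.le, uIcc_of_le (by linarith [hh.1])]
      exact Icc_subset_Icc_right (by linarith [hh.1]))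
  have hi2 : IntervalIntegrable (fun s => deriv W s * (x₀ + h - s) ^ (-α)) volume x₀ (x₀ + h) :=
    hi.mono_set (by
      rw [uIcc_of_le (by linarith [hh.1]), uIcc_of_le (by linarith [hh.1])]
      exact Icc_subset_Icc_left hx₀.le)
  simp only [mul_sub] at hA
  rw [intervalIntegral.integral_sub hi1 (hinteg x₀ hx₀)] at hA
  rw [← intervalIntegral.integral_add_adjacent_intervals hi1 hi2] at hlt'
  have hsub : ∫ s in x₀..(x₀ + h), deriv W s * (x₀ + h - s) ^ (-α)
      = h * (h ^ (-α) * ∫ θ in (0:ℝ)..1, deriv W (x₀ + h * θ) * (1 - θ) ^ (-α)) := by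
    have := intervalIntegral.mul_integral_comp_add_mul (a := 0) (b := 1)
      (f := fun s => deriv W s * (x₀ + h - s) ^ (-α)) (c := h) (d := x₀)
    simp only [mul_zero, add_zero, mul_one] at this
    rw [← this, ← intervalIntegral.integral_const_mul (h ^ (-α))]
    congr 1
    refine intervalIntegral.integral_congr fun θ hθ => ?_
    rw [uIcc_of_le zero_le_one] at hθ
    have e : x₀ + h - (x₀ + h * θ) = h * (1 - θ) := by ring
    simp only [e]
    rw [Real.mul_rpow hh.1.le (by linarith [hθ.2])]
    ring
  have : 0 ≤ h * (h ^ (-α) * ∫ θ in (0:ℝ)..1, deriv W (x₀ + h * θ) * (1 - θ) ^ (-α)) :=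
    mul_nonneg hh.1.le (mul_nonneg (Real.rpow_nonneg hh.1.le _) hB)
  linarith

/-- a self-similar supersolution `u(x,t) = U(x t^{−1/(1+α)})` of the
fractional diffusion inequality cannot attain its minimum over `[0,x₁]` in the
interior: the minimum equals `min (U 0) (U x₁)`. Here `U ∈ C^{1+α}([0,∞))`, i.e.
`U` is `C¹` on `[0,∞)` with locally `α`-Hölder derivative. -/
theorem no_interior_minimum
    (α x₁ : ℝ) (hα : α ∈ Set.Ioo (0:ℝ) 1) (hx₁ : 0 < x₁)
    (U : ℝ → ℝ)
    (hU1 : ContDiffOn ℝ 1 U (Set.Ici 0))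
    (hUhol : ∀ R > (0:ℝ), ∃ C : NNReal,
      HolderOnWith C ⟨α, hα.1.le⟩ (deriv U) (Set.Icc 0 R))
    (u : ℝ → ℝ → ℝ)
    (hu : ∀ x t, u x t = U (x * t ^ (-((1:ℝ)/(1+α)))))
    (hsuper : ∀ t ∈ Set.Ioo (1:ℝ) 2, ∀ x ∈ Set.Ioo 0 (x₁ * t ^ ((1:ℝ)/(1+α))),
      0 < deriv (fun τ => u x τ) t - deriv (fun ξ => caputo α (fun y => u y t) ξ) x) :
    sInf (U '' Set.Icc 0 x₁) = min (U 0) (U x₁) := by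
  have hc : ContinuousOn U (Ici 0) := hU1.continuousOn
  have hd : ∀ s > 0, DifferentiableAt ℝ U s := fun s hs =>
    (hU1.differentiableOn one_ne_zero s (mem_Ici.2 (le_of_lt hs))).differentiableAt
      (Ici_mem_nhds hs)
  have hV : ContinuousOn (deriv U) (Ici 0) := by
    intro s hs
    have hs' : 0 ≤ s := hs
    obtain ⟨C, hC⟩ := hUhol (s + 1) (by linarith)
    have h1 := hC.continuousOn (by exact hα.1) s ⟨hs', by linarith⟩
    refine h1.mono_of_mem_nhdsWithin ?_
    rw [← Ici_inter_Iic]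
    exact Filter.inter_mem self_mem_nhdsWithin
      (nhdsWithin_le_nhds (Iic_mem_nhds (by linarith)))
  obtain ⟨y, hy, hmin⟩ := (isCompact_Icc (a := 0) (b := x₁)).exists_isMinOn
    (nonempty_Icc.2 hx₁.le) (hc.mono Icc_subset_Ici_self)
  have hmin' : ∀ s ∈ Icc 0 x₁, U y ≤ U s := fun s hs => hmin hs
  have hinf : sInf (U '' Icc 0 x₁) = U y :=
    IsLeast.csInf_eq ⟨mem_image_of_mem U hy, by rintro _ ⟨s, hs, rfl⟩; exact hmin' s hs⟩
  rw [hinf]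
  have h0 := hmin' 0 ⟨le_rfl, hx₁.le⟩
  have h1 := hmin' x₁ ⟨hx₁.le, le_rfl⟩
  rcases hy.1.eq_or_lt with rfl | hy0
  · rw [min_eq_left h1]
  rcases hy.2.eq_or_lt with rfl | hy1
  · rw [min_eq_right h0]
  exfalso
  have ht : (0:ℝ) < 3 / 2 := by norm_num
  set c : ℝ := (3 / 2 : ℝ) ^ (-((1:ℝ)/(1+α))) with hcdef
  have hcpos : 0 < c := Real.rpow_pos_of_pos ht _
  have hcinv : (3 / 2 : ℝ) ^ ((1:ℝ)/(1+α)) = c⁻¹ := by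
    rw [hcdef, Real.rpow_neg ht.le, inv_inv]
  have hyc : y / c * c = y := div_mul_cancel₀ _ hcpos.ne'
  have hsup := hsuper (3 / 2) ⟨by norm_num, by norm_num⟩ (y / c)
    ⟨div_pos hy0 hcpos, by
      rw [hcinv, ← div_eq_mul_inv]; exact div_lt_div_of_pos_right hy1 hcpos⟩
  have hU' : deriv U y = 0 :=
    (hmin.isLocalMin (Icc_mem_nhds hy0 hy1)).deriv_eq_zero
  have htime : deriv (fun τ => u (y / c) τ) (3 / 2) = 0 := by
    have e1 : HasDerivAt (fun τ : ℝ => y / c * τ ^ (-((1:ℝ)/(1+α)))) _ (3 / 2) :=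
      ((hasDerivAt_id (3 / 2 : ℝ)).rpow_const (Or.inl ht.ne')).const_mul (y / c)
    have e2 : HasDerivAt U 0 (y / c * (3 / 2 : ℝ) ^ (-((1:ℝ)/(1+α)))) := by
      rw [← hcdef, hyc, ← hU']
      exact (hd y hy0).hasDerivAt
    simp only [hu]
    exact (e2.comp (3 / 2 : ℝ) e1).deriv.trans (zero_mul _)
  have hspace := deriv_caputo_nonneg_of_min (x₀ := y / c) (X := x₁ / c)
    (W := fun z => u z (3 / 2)) hα (div_pos hy0 hcpos)
    (div_lt_div_of_pos_right hy1 hcpos) ?_ ?_ ?_ ?_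
  · rw [htime] at hsup
    linarith
  all_goals simp only [hu, ← hcdef]
  · exact hc.comp (by fun_prop) fun s hs => mul_nonneg hs hcpos.le
  · intro s hs
    exact (hd _ (mul_pos hs hcpos)).comp s (differentiableAt_id.mul_const c)
  · have e : deriv (fun z => U (z * c)) = fun s => c * deriv U (s * c) := by
      funext s
      simpa [mul_comm] using deriv_comp_mul_left c U s
    rw [e]
    exact continuousOn_const.mul (hV.comp (by fun_prop) fun s hs => mul_nonneg hs hcpos.le)
  · intro s hs
    rw [hyc]
    exact hmin' _ ⟨mul_nonneg hs.1 hcpos.le, (le_div_iff₀ hcpos).1 hs.2⟩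
end
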